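/- Let p be a prime with p > 3, r a positive integer, and δ ∈ {1,2}. Then Σ_{n=0}^{(p^r−1)/δ} F(n, (p^r−1)/2) ≡ p^{2r} (mod p^{2r+3}), where F(n,k) = (10n² + 12nk + 6n + 4k² + 4k + 1) · (1/2)_n · (1/2 + k)_n^4 / (n!)^5 · (−4)^n. -/

import Mathlib

open Finset

/-- `a ≡ b (mod p^m)` for rationals: the `p`-adic valuation of `a - b` is at least `m`. -/
def pcong (p m : ℕ) (a b : ℚ) : Prop :=
  a = b ∨ (m : ℤ) ≤ padicValRat p (a - b)

/-- The rising factorial `(a)_n = a(a+1)⋯(a+n-1)`. -/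
noncomputable def rf (a : ℚ) (n : ℕ) : ℚ := (ascPochhammer ℚ n).eval a

/-- `F(n,k) = (10n² + 12nk + 6n + 4k² + 4k + 1) · (1/2)_n · (1/2 + k)_n^4 / (n!)^5 · (−4)^n`. -/
noncomputable def F (n k : ℕ) : ℚ :=
  (10 * (n : ℚ) ^ 2 + 12 * n * k + 6 * n + 4 * (k : ℚ) ^ 2 + 4 * k + 1) *
    rf (1/2) n * (rf (1/2 + k) n) ^ 4 / (n.factorial : ℚ) ^ 5 * (-4) ^ n

/-- The rational `x` is integral at `p` and reduces to `c` modulo `p`. -/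
def ReducesTo (p : ℕ) [Fact p.Prime] (x : ℚ) (c : ZMod p) : Prop :=
  ∃ a b : ℤ, (b : ZMod p) ≠ 0 ∧ x = a / b ∧ c = a / b

namespace ReducesTo

theorem denom_ne_zero {p : ℕ} {b : ℤ} (hb : (b : ZMod p) ≠ 0) : (b : ℚ) ≠ 0 := by
  rintro h
  have : b = 0 := by exact_mod_cast h
  simp [this] at hb

variable {p : ℕ} [hp : Fact p.Prime]

theorem intCast (a : ℤ) : ReducesTo p a a := ⟨a, 1, by simp, by simp, by simp⟩

theorem natCast (a : ℕ) : ReducesTo p a a := by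
  simpa using intCast (p := p) (a : ℤ)

theorem ofNat (a : ℕ) [a.AtLeastTwo] :
    ReducesTo p (OfNat.ofNat a : ℚ) (OfNat.ofNat a : ZMod p) := natCast a

theorem zero : ReducesTo p 0 0 := by simpa using natCast (p := p) 0

theorem one : ReducesTo p 1 1 := by simpa using natCast (p := p) 1

theorem prime_self : ReducesTo p p 0 := by simpa using natCast (p := p) p

theorem add {x y : ℚ} {c d : ZMod p} (hx : ReducesTo p x c)
    (hy : ReducesTo p y d) : ReducesTo p (x + y) (c + d) := by
  obtain ⟨a, b, hb, rfl, rfl⟩ := hx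
  obtain ⟨a', b', hb', rfl, rfl⟩ := hy
  have h := denom_ne_zero hb
  have h' := denom_ne_zero hb'
  refine ⟨a * b' + b * a', b * b', by push_cast; exact mul_ne_zero hb hb', ?_, ?_⟩
  · push_cast; rw [div_add_div _ _ h h']
  · push_cast; rw [div_add_div _ _ hb hb']

theorem mul {x y : ℚ} {c d : ZMod p} (hx : ReducesTo p x c)
    (hy : ReducesTo p y d) : ReducesTo p (x * y) (c * d) := by
  obtain ⟨a, b, hb, rfl, rfl⟩ := hx
  obtain ⟨a', b', hb', rfl, rfl⟩ := hy
  refine ⟨a * a', b * b', by push_cast; exact mul_ne_zero hb hb', ?_, ?_⟩ <;>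
    push_cast <;> rw [div_mul_div_comm]

theorem neg {x : ℚ} {c : ZMod p} (hx : ReducesTo p x c) :
    ReducesTo p (-x) (-c) := by
  simpa using (intCast (p := p) (-1)).mul hx

theorem inv {x : ℚ} {c : ZMod p} (hx : ReducesTo p x c) (hc : c ≠ 0) :
    ReducesTo p x⁻¹ c⁻¹ := by
  obtain ⟨a, b, hb, rfl, rfl⟩ := hx
  refine ⟨b, a, fun h => hc (by simp [h]), ?_, ?_⟩ <;> rw [inv_div]

theorem div {x y : ℚ} {c d : ZMod p} (hx : ReducesTo p x c)
    (hy : ReducesTo p y d) (hd : d ≠ 0) : ReducesTo p (x / y) (c / d) := by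
  simpa only [div_eq_mul_inv] using hx.mul (hy.inv hd)

theorem pow {x : ℚ} {c : ZMod p} (hx : ReducesTo p x c) (n : ℕ) :
    ReducesTo p (x ^ n) (c ^ n) := by
  induction n with
  | zero => simpa using one
  | succ n ih => simpa only [pow_succ] using ih.mul hx

theorem sum {ι : Type*} (s : Finset ι) {x : ι → ℚ} {c : ι → ZMod p}
    (h : ∀ i ∈ s, ReducesTo p (x i) (c i)) :
    ReducesTo p (∑ i ∈ s, x i) (∑ i ∈ s, c i) := by
  classical
  induction s using Finset.induction_on with
  | empty => simpa using zero
  | insert i s hi ih =>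
    rw [sum_insert hi, sum_insert hi]
    exact (h i (mem_insert_self i s)).add (ih fun j hj => h j (mem_insert_of_mem hj))

theorem prod_one {ι : Type*} (s : Finset ι) {x : ι → ℚ}
    (h : ∀ i ∈ s, ReducesTo p (x i) 1) : ReducesTo p (∏ i ∈ s, x i) 1 := by
  classical
  induction s using Finset.induction_on with
  | empty => simpa using one
  | insert i s hi ih =>
    rw [prod_insert hi]
    simpa using (h i (mem_insert_self i s)).mul (ih fun j hj => h j (mem_insert_of_mem hj))

theorem unique {x : ℚ} {c d : ZMod p} (hx : ReducesTo p x c)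
    (hy : ReducesTo p x d) : c = d := by
  obtain ⟨a, b, hb, rfl, rfl⟩ := hx
  obtain ⟨a', b', hb', h, rfl⟩ := hy
  rw [div_eq_div_iff (denom_ne_zero hb) (denom_ne_zero hb')] at h
  rw [div_eq_div_iff hb hb']
  have h' : a * b' = a' * b := by exact_mod_cast h
  exact_mod_cast congrArg (Int.cast : ℤ → ZMod p) h'

/-- A multiple of `p ^ m` by a rational reducing to zero is divisible by `p ^ (m + 1)`. -/
theorem pcong_of_sub_div {a b : ℚ} {m : ℕ}
    (h : ReducesTo p ((a - b) / (p : ℚ) ^ m) 0) : pcong p (m + 1) a b := by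
  obtain ⟨u, v, hv, hx, hc⟩ := h
  by_cases hab : a = b
  · exact Or.inl hab
  right
  have hp0 : (p : ℚ) ≠ 0 := by exact_mod_cast hp.out.ne_zero
  have hu : (u : ZMod p) = 0 := by
    have := hc.symm
    rw [div_eq_zero_iff] at this
    exact this.resolve_right hv
  obtain ⟨w, rfl⟩ := (ZMod.intCast_zmod_eq_zero_iff_dvd u p).1 hu
  have hv0 := denom_ne_zero hv
  have heq : a - b = (p : ℚ) ^ (m + 1) * ((w : ℚ) / v) := by
    rw [div_eq_iff (pow_ne_zero _ hp0)] at hx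
    rw [hx]; push_cast; ring
  have hw : (w : ℚ) ≠ 0 := by
    rintro h0
    rw [h0] at heq
    exact hab (sub_eq_zero.1 (by simpa using heq))
  have hpv : ¬ (p : ℤ) ∣ v := fun h => hv ((ZMod.intCast_zmod_eq_zero_iff_dvd v p).2 h)
  rw [heq, padicValRat.mul (pow_ne_zero _ hp0) (div_ne_zero hw hv0), padicValRat.div hw hv0,
    padicValRat.pow, padicValRat.self hp.out.one_lt, padicValRat.of_int, padicValRat.of_int,
    padicValInt.eq_zero_of_not_dvd hpv]
  push_cast
  linarith [Int.natCast_nonneg (padicValInt p w)]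

end ReducesTo

/-- Indefinite summation in `k` behind Apéry's acceleration of `ζ(3)`. -/
theorem apery_inner_sum (N K : ℕ) (hK : K ≤ N) :
    ∑ k ∈ range K, (-1 : ℚ) ^ (k + 1) / (2 * (k + 1 : ℚ) ^ 3) *
      (1 / ((N + 1 + (k + 1)).choose (k + 1) * (N + 1).choose (k + 1)) -
        1 / ((N + (k + 1)).choose (k + 1) * N.choose (k + 1))) =
      1 / (N + 1 : ℚ) * (1 / (N + 1 : ℚ) ^ 2 -
        (-1) ^ K / ((N + 1 : ℚ) ^ 2 * ((N + 1 + K).choose K * N.choose K))) := by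
  induction K with
  | zero => simp
  | succ K ih =>
    rw [sum_range_succ, ih (by omega)]
    obtain ⟨t, rfl⟩ : ∃ t, N = K + 1 + t := ⟨N - (K + 1), by omega⟩
    have hK1 : (K + 1 : ℚ) ≠ 0 := by positivity
    have hX : ((K + 1 + t + 1 + K).choose K : ℚ) ≠ 0 := by
      exact_mod_cast (Nat.choose_pos (by omega)).ne'
    have hY : ((K + 1 + t).choose K : ℚ) ≠ 0 := by
      exact_mod_cast (Nat.choose_pos (by omega)).ne'
    have e1 : ((K + 1 + t + 1 + (K + 1)).choose (K + 1) : ℚ) =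
        (K + 1 + t + 1 + K).choose K * (2 * K + t + 3) / (K + 1) := by
      rw [eq_div_iff hK1]
      have := Nat.add_one_mul_choose_eq (K + 1 + t + 1 + K) K
      rw [show K + 1 + t + 1 + K + 1 = K + 1 + t + 1 + (K + 1) by ring] at this
      have h := congrArg (Nat.cast : ℕ → ℚ) this
      push_cast at h
      linarith
    have e2 : ((K + 1 + t).choose (K + 1) : ℚ) = (K + 1 + t).choose K * (t + 1) / (K + 1) := by
      rw [eq_div_iff hK1]
      have := Nat.choose_succ_right_eq (K + 1 + t) K
      rw [show K + 1 + t - K = t + 1 by omega] at this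
      exact_mod_cast this
    have e3 : ((K + 1 + t + 1).choose (K + 1) : ℚ) =
        (K + 1 + t).choose K * (K + t + 2) / (K + 1) := by
      rw [eq_div_iff hK1]
      have h := congrArg (Nat.cast : ℕ → ℚ) (Nat.add_one_mul_choose_eq (K + 1 + t) K)
      push_cast at h
      linarith
    have e4 : ((K + 1 + t + (K + 1)).choose (K + 1) : ℚ) =
        (K + 1 + t + 1 + K).choose K * (K + t + 2) / (K + 1) := by
      rw [eq_div_iff hK1]
      have := Nat.choose_succ_right_eq (K + 1 + t + 1 + K) K
      rw [show K + 1 + t + 1 + K - K = K + t + 2 by omega,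
        show K + 1 + t + 1 + K = K + 1 + t + (K + 1) by ring] at this
      rw [show K + 1 + t + 1 + K = K + 1 + t + (K + 1) by ring]
      exact_mod_cast this
    rw [e1, e2, e3, e4]
    generalize ((K + 1 + t + 1 + K).choose K : ℚ) = X at *
    generalize ((K + 1 + t).choose K : ℚ) = Y at *
    have h1 : (2 * K + t + 3 : ℚ) ≠ 0 := by positivity
    have h2 : (K + t + 2 : ℚ) ≠ 0 := by positivity
    have h3 : (t + 1 : ℚ) ≠ 0 := by positivity
    push_cast
    rw [show (K + 1 + t + 1 : ℚ) = K + t + 2 by ring, pow_succ]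
    field_simp
    ring

/-- Apéry's finite identity for `ζ(3)`. -/
theorem apery_identity (N : ℕ) :
    ∑ k ∈ range N, (-1 : ℚ) ^ (k + 1) /
        (2 * (k + 1 : ℚ) ^ 3 * ((N + (k + 1)).choose (k + 1) * N.choose (k + 1))) =
      ∑ k ∈ range N, 1 / (k + 1 : ℚ) ^ 3 +
        5 / 2 * ∑ k ∈ range N, (-1 : ℚ) ^ (k + 1) /
          ((k + 1 : ℚ) ^ 3 * (2 * (k + 1)).choose (k + 1)) := by
  induction N with
  | zero => simp
  | succ N ih =>
    have hin := apery_inner_sum N N le_rfl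
    simp only [mul_sub, mul_one_div, div_div] at hin
    rw [sum_sub_distrib, ih] at hin
    rw [sum_range_succ, sum_range_succ _ N, sum_range_succ _ N]
    rw [sub_eq_iff_eq_add] at hin
    rw [hin]
    have hC : ((2 * (N + 1)).choose (N + 1) : ℚ) = 2 * (N + 1 + N).choose N := by
      have h := Nat.add_one_mul_choose_eq (N + 1 + N) N
      have h' : (N + 1) * (2 * (N + 1)).choose (N + 1) =
          (N + 1) * (2 * (N + 1 + N).choose N) := by
        rw [show 2 * (N + 1) = N + 1 + N + 1 by ring]
        linarith
      exact_mod_cast Nat.eq_of_mul_eq_mul_left (Nat.succ_pos N) h'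
    rw [show N + 1 + (N + 1) = 2 * (N + 1) by ring, hC]
    have hX : ((N + 1 + N).choose N : ℚ) ≠ 0 := by
      exact_mod_cast (Nat.choose_pos (by omega)).ne'
    simp only [Nat.choose_self, Nat.cast_one]
    field_simp
    ring

section ModPrime

variable {p : ℕ} [hp : Fact p.Prime]

theorem ZMod.natCast_ne_zero_of_lt {n : ℕ} (h0 : 0 < n) (hn : n < p) : (n : ZMod p) ≠ 0 := by
  rw [Ne, ZMod.natCast_eq_zero_iff]
  exact Nat.not_dvd_of_pos_of_lt h0 hn

theorem ZMod.factorial_ne_zero {n : ℕ} (hn : n < p) : (n.factorial : ZMod p) ≠ 0 := by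
  rw [Ne, ZMod.natCast_eq_zero_iff, hp.out.dvd_factorial]
  omega

/-- The two-sided form of Wilson's theorem. -/
theorem ZMod.factorial_mul_factorial (a b : ℕ) (h : a + b + 1 = p) :
    (a.factorial * b.factorial : ZMod p) = (-1) ^ (a + 1) := by
  induction a generalizing b with
  | zero =>
    have := ZMod.wilsons_lemma p
    rw [show p - 1 = b by omega] at this
    simp [this]
  | succ a ih =>
    have hi := ih (b + 1) (by omega)
    have hb : ((b + 1 : ℕ) : ZMod p) = -((a + 1 : ℕ) : ZMod p) := by
      rw [eq_neg_iff_add_eq_zero]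
      rw [← Nat.cast_add, show b + 1 + (a + 1) = p by omega, ZMod.natCast_self]
    rw [Nat.factorial_succ, Nat.cast_mul, hb] at hi
    rw [Nat.factorial_succ, Nat.cast_mul, pow_succ, ← hi]
    ring

theorem ZMod.centralBinom_eq_zero {m : ℕ} (hm : m < p) (h : p ≤ 2 * m) :
    ((2 * m).choose m : ZMod p) = 0 := by
  rw [ZMod.natCast_eq_zero_iff]
  exact hp.out.dvd_choose hm (by omega) h

theorem ZMod.choose_prime_sub_one {k : ℕ} (hk : k < p) :
    ((p - 1).choose k : ZMod p) = (-1) ^ k := by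
  have h := congrArg (Nat.cast : ℕ → ZMod p)
    (Nat.choose_mul_factorial_mul_factorial (show k ≤ p - 1 by omega))
  push_cast at h
  rw [mul_assoc, ZMod.factorial_mul_factorial k (p - 1 - k) (by omega), ZMod.wilsons_lemma,
    pow_succ] at h
  have h1 : ((-1 : ZMod p) ^ k) * (-1) ^ k = 1 := by rw [← mul_pow]; simp
  linear_combination (-(-1 : ZMod p) ^ k) * h - ((p - 1).choose k : ZMod p) * h1

theorem ZMod.choose_prime_add (k : ℕ) (hk : k < p) :
    ((p + k).choose k : ZMod p) = 1 := by
  have h := Choose.choose_modEq_choose_mod_mul_choose_div_nat (n := p + k) (k := k) (p := p)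
  rw [Nat.add_mod_left, Nat.mod_eq_of_lt hk, Nat.choose_self, Nat.div_eq_of_lt hk,
    Nat.choose_zero_right] at h
  simpa using (ZMod.natCast_eq_natCast_iff _ _ _).2 h

theorem ZMod.choose_prime_pow_mul (s a b : ℕ) :
    ((p ^ s * a).choose (p ^ s * b) : ZMod p) = (a.choose b : ZMod p) := by
  induction s with
  | zero => simp
  | succ s ih =>
    rw [← ih]
    have h := Choose.choose_modEq_choose_mod_mul_choose_div_nat
      (n := p ^ (s + 1) * a) (k := p ^ (s + 1) * b) (p := p)
    rw [pow_succ', mul_assoc, mul_assoc, Nat.mul_mod_right, Nat.mul_mod_right,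
      Nat.mul_div_cancel_left _ hp.out.pos, Nat.mul_div_cancel_left _ hp.out.pos,
      Nat.choose_self, one_mul] at h
    rw [pow_succ', mul_assoc, mul_assoc]
    exact (ZMod.natCast_eq_natCast_iff _ _ _).2 h

/-- The reflection `n ↦ p - n` for central binomial coefficients modulo `p`. -/
theorem reducesTo_prime_div_centralBinom (h2 : 2 < p) {n m : ℕ} (hn : 0 < n) (hm : 0 < m)
    (h : n + m = p) :
    ReducesTo p (p / (2 * n).choose n) (-(m * (2 * m).choose m) / 2) := by
  have two : (2 : ZMod p) ≠ 0 := by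
    exact_mod_cast ZMod.natCast_ne_zero_of_lt (p := p) (n := 2) (by omega) h2
  rcases Nat.lt_or_ge (2 * n) p with hlt | hge
  · rw [ZMod.centralBinom_eq_zero (p := p) (m := m) (by omega) (by omega)]
    have hne : ((2 * n).choose n : ZMod p) ≠ 0 := by
      intro h0
      have h := congrArg (Nat.cast : ℕ → ZMod p)
        (Nat.choose_mul_factorial_mul_factorial (show n ≤ 2 * n by omega))
      push_cast at h
      rw [h0, zero_mul, zero_mul] at h
      exact ZMod.factorial_ne_zero hlt h.symm
    simpa using ReducesTo.prime_self.div (ReducesTo.natCast ((2 * n).choose n)) hne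
  · obtain ⟨t, ht⟩ : ∃ t, 2 * n = p + t := ⟨2 * n - p, by omega⟩
    have hfac : (2 * n).choose n * (n.factorial * n.factorial) =
        p * ((p - 1).factorial * (p + 1).ascFactorial t) := by
      have h1 := Nat.choose_mul_factorial_mul_factorial (show n ≤ 2 * n by omega)
      rw [show 2 * n - n = n by omega] at h1
      rw [← mul_assoc, h1, ← mul_assoc, Nat.mul_factorial_pred hp.out.ne_zero,
        Nat.factorial_mul_ascFactorial, ht]
    have hasc : ((p + 1).ascFactorial t : ZMod p) = t.factorial := by
      rw [Nat.ascFactorial_eq_prod_range, ← prod_range_add_one_eq_factorial]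
      push_cast
      simp [add_comm]
    have hD : (((p - 1).factorial * (p + 1).ascFactorial t : ℕ) : ZMod p) = -t.factorial := by
      push_cast
      rw [ZMod.wilsons_lemma, hasc]
      ring
    have htf : (t.factorial : ZMod p) ≠ 0 := ZMod.factorial_ne_zero (by omega)
    have hC0 : ((2 * n).choose n : ℚ) ≠ 0 := by
      exact_mod_cast (Nat.choose_pos (by omega)).ne'
    have hD0 : (((p - 1).factorial * (p + 1).ascFactorial t : ℕ) : ℚ) ≠ 0 := by
      exact_mod_cast (Nat.mul_pos (Nat.factorial_pos _) (Nat.ascFactorial_pos _ _)).ne'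
    have key := (ReducesTo.natCast (p := p) (n.factorial * n.factorial)).div
      (ReducesTo.natCast ((p - 1).factorial * (p + 1).ascFactorial t))
      (by rw [hD]; exact neg_ne_zero.2 htf)
    convert key using 1
    · rw [div_eq_div_iff hC0 hD0]
      have := congrArg (Nat.cast : ℕ → ℚ) hfac
      push_cast at this ⊢
      linarith
    · rw [hD]
      obtain ⟨a, rfl⟩ : ∃ a, m = a + 1 := ⟨m - 1, by omega⟩
      have w1 := ZMod.factorial_mul_factorial (p := p) a n (by omega)
      have w2 := ZMod.factorial_mul_factorial (p := p) (2 * a + 1) t (by omega)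
      rw [show 2 * a + 1 + 1 = 2 * (a + 1) by ring, pow_mul, neg_one_sq, one_pow] at w2
      have hc := congrArg (Nat.cast : ℕ → ZMod p)
        (Nat.choose_mul_factorial_mul_factorial (show a + 1 ≤ 2 * (a + 1) by omega))
      rw [show 2 * (a + 1) - (a + 1) = a + 1 by omega,
        show (2 * (a + 1)).factorial = 2 * (a + 1) * (2 * a + 1).factorial by
          rw [show 2 * (a + 1) = 2 * a + 1 + 1 by ring, Nat.factorial_succ],
        Nat.factorial_succ] at hc
      push_cast at hc ⊢
      have ha1 : (a + 1 : ZMod p) ≠ 0 := by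
        exact_mod_cast ZMod.natCast_ne_zero_of_lt (p := p) (n := a + 1) (by omega) (by omega)
      have hc' : ((2 * (a + 1)).choose (a + 1) : ZMod p) * (a + 1) * (a.factorial) ^ 2 =
          2 * (2 * a + 1).factorial := by
        apply mul_left_cancel₀ ha1
        linear_combination hc
      have w1' : (a.factorial : ZMod p) ^ 2 * (n.factorial : ZMod p) ^ 2 = 1 := by
        rw [← mul_pow, w1, ← pow_mul, mul_comm, pow_mul, neg_one_sq, one_pow]
      rw [div_eq_div_iff two (neg_ne_zero.2 htf)]
      linear_combination (n.factorial : ZMod p) ^ 2 * t.factorial * hc' +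
        2 * (n.factorial : ZMod p) ^ 2 * w2 -
        ((2 * (a + 1)).choose (a + 1) : ZMod p) * (a + 1) * t.factorial * w1'

theorem ZMod.sum_inv_sq_eq_zero (h3 : 3 < p) :
    ∑ k ∈ range (p - 1), 1 / ((k + 1 : ℕ) : ZMod p) ^ 2 = 0 := by
  have key : ∑ x : ZMod p, (x⁻¹) ^ 2 = 0 := by
    rw [← FiniteField.sum_pow_lt_card_sub_one (K := ZMod p) 2 (by rw [ZMod.card]; omega)]
    exact Fintype.sum_equiv (Equiv.inv (ZMod p)) _ _ fun x => rfl
  have hsum : ∑ k ∈ range p, (((k : ℕ) : ZMod p)⁻¹) ^ 2 = ∑ x : ZMod p, (x⁻¹) ^ 2 := by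
    refine sum_bij' (fun k _ => (k : ZMod p)) (fun x _ => x.val) (by simp)
      (fun x _ => mem_range.2 (ZMod.val_lt x)) ?_ (by simp) (by simp)
    intro k hk
    exact ZMod.val_cast_of_lt (mem_range.1 hk)
  have hr : range p = range (p - 1 + 1) := by rw [Nat.sub_add_cancel hp.out.one_le]
  rw [key, hr, sum_range_succ'] at hsum
  simpa using hsum

/-- The mod-`p` analogue of the Apéry series. -/
theorem ZMod.five_mul_sum_centralBinom (h3 : 3 < p) :
    5 * ∑ m ∈ range (p - 1), (-1 : ZMod p) ^ (m + 1) * (2 * (m + 1)).choose (m + 1) /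
      ((m + 1 : ℕ) : ZMod p) ^ 2 = 0 := by
  have hp0 : (p : ℚ) ≠ 0 := by exact_mod_cast hp.out.ne_zero
  have two : (2 : ZMod p) ≠ 0 := by
    exact_mod_cast ZMod.natCast_ne_zero_of_lt (p := p) (n := 2) (by omega) (by omega)
  have hk0 : ∀ k ∈ range (p - 1), ((k + 1 : ℕ) : ZMod p) ≠ 0 := fun k hk => by
    have := mem_range.1 hk
    exact ZMod.natCast_ne_zero_of_lt (by omega) (by omega)
  have hL : ReducesTo p (p * ∑ k ∈ range (p - 1), (-1 : ℚ) ^ (k + 1) /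
      (2 * (k + 1 : ℚ) ^ 3 * ((p - 1 + (k + 1)).choose (k + 1) * (p - 1).choose (k + 1)))) 0 := by
    have h0 : ∑ k ∈ range (p - 1), 1 / (2 * ((k + 1 : ℕ) : ZMod p) ^ 2) = 0 := by
      simp_rw [← div_div, div_right_comm _ (2 : ZMod p)]
      rw [← sum_div, ZMod.sum_inv_sq_eq_zero h3, zero_div]
    rw [← h0, mul_sum]
    refine ReducesTo.sum _ fun k hk => ?_
    have hkp := mem_range.1 hk
    have hkp' : k + 1 < p := by omega
    have c1 := ZMod.choose_prime_sub_one (p := p) hkp'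
    have c2 := ZMod.choose_prime_add (p := p) k (by omega)
    have s0 : ((-1 : ZMod p) ^ (k + 1)) ≠ 0 := pow_ne_zero _ (by simp)
    have key := ((ReducesTo.intCast (p := p) (-1)).pow (k + 1)).div
      (((ReducesTo.ofNat 2).mul ((ReducesTo.natCast (k + 1)).pow 2)).mul
        ((ReducesTo.natCast ((p + k).choose k)).mul
          (ReducesTo.natCast ((p - 1).choose (k + 1)))))
      (by
        rw [c1, c2, one_mul]
        exact mul_ne_zero (mul_ne_zero two (pow_ne_zero _ (hk0 k hk))) s0)
    convert key using 1
    · have hch : ((p - 1 + (k + 1)).choose (k + 1) : ℚ) =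
          p * (p + k).choose k / (k + 1) := by
        rw [eq_div_iff (by positivity), show p - 1 + (k + 1) = p + k by omega]
        have := Nat.choose_succ_right_eq (p + k) k
        rw [Nat.add_sub_cancel, mul_comm _ p] at this
        exact_mod_cast this
      have hX : ((p + k).choose k : ℚ) ≠ 0 := by
        exact_mod_cast (Nat.choose_pos (by omega)).ne'
      have hY : ((p - 1).choose (k + 1) : ℚ) ≠ 0 := by
        exact_mod_cast (Nat.choose_pos (by omega)).ne'
      rw [hch]
      push_cast
      field_simp
    · rw [c1, c2]
      push_cast
      have := hk0 k hk
      push_cast at this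
      field_simp
  have hH : ReducesTo p (p * ∑ k ∈ range (p - 1), 1 / (k + 1 : ℚ) ^ 3) 0 := by
    have := ReducesTo.prime_self.mul (ReducesTo.sum (p := p) (range (p - 1))
      fun k hk => ReducesTo.one.div ((ReducesTo.natCast (k + 1)).pow 3)
        (pow_ne_zero 3 (hk0 k hk)))
    simpa using this
  have hR : ReducesTo p (5 * ∑ k ∈ range (p - 1), (-1 : ℚ) ^ (k + 1) /
      ((k + 1 : ℚ) ^ 3) * (p / (2 * (k + 1)).choose (k + 1)))
      (5 * ∑ k ∈ range (p - 1), (-1 : ZMod p) ^ (k + 1) / (((k + 1 : ℕ) : ZMod p) ^ 3) *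
        (-(((p - 1 - k : ℕ) : ZMod p) * (2 * (p - 1 - k)).choose (p - 1 - k)) / 2)) := by
    refine (ReducesTo.ofNat 5).mul (ReducesTo.sum _ fun k hk => ?_)
    have hkp := mem_range.1 hk
    have h1 := ((ReducesTo.intCast (p := p) (-1)).pow (k + 1)).div
      ((ReducesTo.natCast (k + 1)).pow 3) (pow_ne_zero 3 (hk0 k hk))
    have h2 := reducesTo_prime_div_centralBinom (p := p) (by omega) (n := k + 1)
      (m := p - 1 - k) (by omega) (by omega) (by omega)
    simpa using h1.mul h2
  have hEq : 5 * ∑ k ∈ range (p - 1), (-1 : ℚ) ^ (k + 1) /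
      ((k + 1 : ℚ) ^ 3) * (p / (2 * (k + 1)).choose (k + 1)) =
      2 * (p * ∑ k ∈ range (p - 1), (-1 : ℚ) ^ (k + 1) /
      (2 * (k + 1 : ℚ) ^ 3 * ((p - 1 + (k + 1)).choose (k + 1) * (p - 1).choose (k + 1))) +
      -(p * ∑ k ∈ range (p - 1), 1 / (k + 1 : ℚ) ^ 3)) := by
    rw [apery_identity (p - 1)]
    have : ∑ k ∈ range (p - 1), (-1 : ℚ) ^ (k + 1) /
        ((k + 1 : ℚ) ^ 3) * (p / (2 * (k + 1)).choose (k + 1)) =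
        p * ∑ k ∈ range (p - 1), (-1 : ℚ) ^ (k + 1) /
          ((k + 1 : ℚ) ^ 3 * (2 * (k + 1)).choose (k + 1)) := by
      rw [mul_sum]
      refine sum_congr rfl fun k _ => ?_
      rw [div_mul_div_comm]
      ring
    rw [this]
    ring
  rw [hEq] at hR
  have hz := hR.unique ((ReducesTo.ofNat 2).mul (hL.add hH.neg))
  rw [neg_zero, add_zero, mul_zero] at hz
  rw [← sum_range_reflect] at hz
  have hhalf : ∑ j ∈ range (p - 1), (-1 : ZMod p) ^ (p - 1 - 1 - j + 1) /
        (((p - 1 - 1 - j + 1 : ℕ) : ZMod p) ^ 3) *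
        (-(((p - 1 - (p - 1 - 1 - j) : ℕ) : ZMod p) *
          (2 * (p - 1 - (p - 1 - 1 - j))).choose (p - 1 - (p - 1 - 1 - j))) / 2) =
      (∑ m ∈ range (p - 1), (-1 : ZMod p) ^ (m + 1) * (2 * (m + 1)).choose (m + 1) /
        ((m + 1 : ℕ) : ZMod p) ^ 2) * (-1 / 2) := by
    rw [sum_mul]
    refine sum_congr rfl fun j hj => ?_
    have hjp := mem_range.1 hj
    have hj0 := hk0 j hj
    rw [show p - 1 - (p - 1 - 1 - j) = j + 1 by omega,
      show p - 1 - 1 - j + 1 = p - (j + 1) by omega, Nat.cast_sub (by omega),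
      ZMod.natCast_self, zero_sub]
    have hodd : Odd p := hp.out.odd_of_ne_two (by omega)
    have hsign : (-1 : ZMod p) ^ (p - (j + 1)) = -(-1) ^ (j + 1) := by
      have h1 : (-1 : ZMod p) ^ (p - (j + 1)) * (-1) ^ (j + 1) = -1 := by
        rw [← pow_add, Nat.sub_add_cancel (by omega), hodd.neg_one_pow]
      have h2 : (-1 : ZMod p) ^ (j + 1) * (-1) ^ (j + 1) = 1 := by rw [← mul_pow]; simp
      linear_combination (-1 : ZMod p) ^ (j + 1) * h1 - (-1 : ZMod p) ^ (p - (j + 1)) * h2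
    rw [hsign]
    field_simp
  rw [hhalf, ← mul_assoc] at hz
  exact (mul_eq_zero.1 hz).resolve_right (div_ne_zero (by simp) two)

end ModPrime

theorem rf_succ (a : ℚ) (n : ℕ) : rf a (n + 1) = rf a n * (a + n) :=
  ascPochhammer_succ_eval n a

theorem rf_half_mul (n : ℕ) :
    rf (1 / 2) n * (-4) ^ n = (-1) ^ n * (2 * n).choose n * n.factorial := by
  induction n with
  | zero => simp [rf]
  | succ n ih =>
    have h := congrArg (Nat.cast : ℕ → ℚ) (Nat.succ_mul_centralBinom_succ n)
    simp only [Nat.centralBinom] at h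
    push_cast at h
    rw [rf_succ, Nat.factorial_succ, pow_succ, pow_succ]
    push_cast
    linear_combination (-4) * (1 / 2 + n : ℚ) * ih + (-1) ^ n * (n.factorial : ℚ) * h

theorem rf_succ_eq_prod (x : ℚ) (n : ℕ) :
    rf x (n + 1) = x / (n + 1) * (∏ j ∈ range n, (1 + x / (j + 1))) * (n + 1).factorial := by
  induction n with
  | zero => simp [rf]
  | succ n ih =>
    rw [rf_succ, ih, prod_range_succ, Nat.factorial_succ (n + 1)]
    push_cast
    field_simp
    ring

theorem F_zero (k : ℕ) : F 0 k = (2 * k + 1) ^ 2 := by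
  simp [F, rf]
  ring

theorem F_succ (n k : ℕ) :
    F (n + 1) k = (2 * k + 1) ^ 2 * (((2 * k + 1) / (n + 1 : ℚ)) ^ 2 *
      (10 + 6 * ((2 * k + 1) / (n + 1 : ℚ)) + ((2 * k + 1) / (n + 1 : ℚ)) ^ 2) / 16 *
      (∏ j ∈ range n, (1 + (2 * k + 1) / (2 * (j + 1 : ℚ)))) ^ 4 *
      ((-1) ^ (n + 1) * (2 * (n + 1)).choose (n + 1))) := by
  have h1 := rf_half_mul (n + 1)
  have h2 := rf_succ_eq_prod (1 / 2 + k) n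
  have h3 : ∀ j : ℕ, (1 / 2 + k : ℚ) / (j + 1) = (2 * k + 1) / (2 * (j + 1 : ℚ)) := by
    intro j
    field_simp
    ring
  simp only [h3] at h2
  have hf : ((n + 1).factorial : ℚ) ≠ 0 := by exact_mod_cast (n + 1).factorial_ne_zero
  have h4 : F (n + 1) k = (10 * ((n + 1 : ℕ) : ℚ) ^ 2 + 12 * (n + 1 : ℕ) * k +
      6 * (n + 1 : ℕ) + 4 * (k : ℚ) ^ 2 + 4 * k + 1) * (rf (1 / 2 + k) (n + 1)) ^ 4 /
      ((n + 1).factorial : ℚ) ^ 5 * (rf (1 / 2) (n + 1) * (-4) ^ (n + 1)) := by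
    rw [F]
    ring
  rw [h4, h1, h2]
  push_cast
  generalize ∏ j ∈ range n, (1 + (2 * k + 1) / (2 * (j + 1 : ℚ))) = P
  field_simp
  ring

theorem Nat.exists_eq_prime_pow_mul_of_lt {p r n : ℕ} (hp : p.Prime) (hn0 : 0 < n)
    (hn : n < p ^ r) : ∃ s m, s < r ∧ ¬ p ∣ m ∧ n = p ^ s * m := by
  obtain ⟨s, m, hm, rfl⟩ := Nat.exists_eq_pow_mul_and_not_dvd hn0.ne' p hp.ne_one
  refine ⟨s, m, ?_, hm, rfl⟩
  have hm0 : 0 < m := Nat.pos_of_mul_pos_left hn0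
  exact (Nat.pow_lt_pow_iff_right hp.one_lt).1 ((Nat.le_mul_of_pos_right _ hm0).trans_lt hn)

section Terms

variable {p : ℕ} [hp : Fact p.Prime]

/-- The reduction modulo `p` of `p ^ r / n`. -/
theorem reducesTo_prime_pow_div {r n : ℕ} (hn0 : 0 < n) (hn : n < p ^ (r + 1)) :
    ReducesTo p ((p : ℚ) ^ r / n)
      (if p ^ r ∣ n then 1 / ((n / p ^ r : ℕ) : ZMod p) else 0) := by
  obtain ⟨s, m, hs, hm, rfl⟩ := Nat.exists_eq_prime_pow_mul_of_lt hp.out hn0 hn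
  have hp0 : (p : ℚ) ≠ 0 := by exact_mod_cast hp.out.ne_zero
  have hm0 : (m : ℚ) ≠ 0 := by
    rintro h
    exact hm (by simp [Nat.cast_eq_zero.1 h])
  have hmz : (m : ZMod p) ≠ 0 := by rwa [Ne, ZMod.natCast_eq_zero_iff]
  obtain ⟨t, rfl⟩ : ∃ t, r = s + t := ⟨r - s, by omega⟩
  have hx : (p : ℚ) ^ (s + t) / ((p ^ s * m : ℕ) : ℚ) = (p : ℚ) ^ t / m := by
    push_cast
    rw [pow_add, mul_div_mul_left _ _ (pow_ne_zero _ hp0)]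
  rw [hx]
  rcases Nat.eq_zero_or_pos t with rfl | ht
  · rw [add_zero, if_pos (dvd_mul_right _ _), Nat.mul_div_cancel_left _ (pow_pos hp.out.pos _),
      pow_zero]
    exact ReducesTo.one.div (ReducesTo.natCast m) hmz
  · rw [if_neg]
    · have := (ReducesTo.prime_self.pow t).div (ReducesTo.natCast m) hmz
      simpa [ht.ne'] using this
    · rw [pow_add, Nat.mul_dvd_mul_iff_left (pow_pos hp.out.pos _)]
      exact fun h => hm ((dvd_pow_self p ht.ne').trans h)

theorem reducesTo_F_succ (h2 : 2 < p) {r n k : ℕ} (hk : 2 * k + 1 = p ^ (r + 1))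
    (hn : n + 1 < p ^ (r + 1)) :
    ReducesTo p (F (n + 1) k / (p : ℚ) ^ (2 * (r + 1) + 2))
      (if p ^ r ∣ n + 1 then 10 / 16 * ((-1) ^ ((n + 1) / p ^ r) *
        (2 * ((n + 1) / p ^ r)).choose ((n + 1) / p ^ r) /
          (((n + 1) / p ^ r : ℕ) : ZMod p) ^ 2) else 0) := by
  have hp0 : (p : ℚ) ≠ 0 := by exact_mod_cast hp.out.ne_zero
  have hkq : (2 * k + 1 : ℚ) = (p : ℚ) ^ (r + 1) := by exact_mod_cast hk
  have two : (2 : ZMod p) ≠ 0 := by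
    exact_mod_cast ZMod.natCast_ne_zero_of_lt (p := p) (n := 2) (by omega) h2
  have h16 : (16 : ZMod p) ≠ 0 := by
    rw [show (16 : ZMod p) = 2 ^ 4 by norm_num]
    exact pow_ne_zero _ two
  have hw := reducesTo_prime_pow_div (p := p) (r := r) (n := n + 1) (by omega) hn
  have hu := ReducesTo.prime_self.mul hw
  rw [zero_mul] at hu
  have hP : ReducesTo p (∏ j ∈ range n, (1 + (2 * k + 1) / (2 * (j + 1 : ℚ)))) 1 := by
    refine ReducesTo.prod_one _ fun j hj => ?_
    have hj' := mem_range.1 hj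
    have := reducesTo_prime_pow_div (p := p) (r := r) (n := j + 1) (by omega) (by omega)
    have h := ReducesTo.one.add
      ((ReducesTo.prime_self.mul this).div (ReducesTo.ofNat (p := p) 2) two)
    rw [zero_mul, zero_div, add_zero] at h
    convert h using 2
    rw [hkq, pow_succ]
    push_cast
    field_simp
  have hC : ReducesTo p ((-1 : ℚ) ^ (n + 1) * (2 * (n + 1)).choose (n + 1))
      ((-1) ^ (n + 1) * (2 * (n + 1)).choose (n + 1)) := by
    simpa using ((ReducesTo.intCast (p := p) (-1)).pow (n + 1)).mul
      (ReducesTo.natCast ((2 * (n + 1)).choose (n + 1)))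
  have key := ((((hw.pow 2).mul (((ReducesTo.ofNat 10).add ((ReducesTo.ofNat 6).mul hu)).add
    (hu.pow 2))).div (ReducesTo.ofNat 16) h16).mul (hP.pow 4)).mul hC
  convert key using 1
  · rw [F_succ, hkq]
    push_cast
    field_simp
    ring
  · split_ifs with hd
    · obtain ⟨m, hm⟩ := hd
      have hodd : Odd (p ^ r) := (hp.out.odd_of_ne_two (by omega)).pow
      rw [hm, Nat.mul_div_cancel_left _ (pow_pos hp.out.pos _), pow_mul, hodd.neg_one_pow,
        show 2 * (p ^ r * m) = p ^ r * (2 * m) by ring, ZMod.choose_prime_pow_mul]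
      ring
    · ring

end Terms

theorem Finset.sum_range_multiples {M : Type*} [AddCommMonoid M] (d N : ℕ) (hd : 0 < d)
    (f : ℕ → M) :
    ∑ n ∈ range N, (if d ∣ n + 1 then f ((n + 1) / d) else 0) =
      ∑ m ∈ range (N / d), f (m + 1) := by
  rw [← sum_filter]
  symm
  refine sum_bij (fun m _ => d * (m + 1) - 1) ?_ ?_ ?_ ?_
  · intro m hm
    have h1 : d * (m + 1) ≤ N := by
      rw [mul_comm]
      exact (Nat.le_div_iff_mul_le hd).1 (mem_range.1 hm)
    have h2 : 0 < d * (m + 1) := by positivity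
    rw [mem_filter, mem_range, Nat.sub_add_cancel h2]
    exact ⟨by omega, dvd_mul_right _ _⟩
  · intro a _ b _ h
    have h1 : 0 < d * (a + 1) := by positivity
    have h2 : 0 < d * (b + 1) := by positivity
    have h3 : d * (a + 1) = d * (b + 1) := by omega
    have := Nat.eq_of_mul_eq_mul_left hd h3
    omega
  · intro n hn
    rw [mem_filter, mem_range] at hn
    obtain ⟨hn, m, hm⟩ := hn
    have hm0 : 0 < m := by
      rcases Nat.eq_zero_or_pos m with rfl | h
      · simp at hm
      · exact h
    refine ⟨m - 1, ?_, by rw [Nat.sub_add_cancel hm0]; omega⟩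
    rw [mem_range, Nat.lt_iff_add_one_le, Nat.sub_add_cancel hm0, Nat.le_div_iff_mul_le hd,
      mul_comm]
    omega
  · intro m _
    have h2 : 0 < d * (m + 1) := by positivity
    rw [Nat.sub_add_cancel h2, Nat.mul_div_cancel_left _ hd]

/-- Truncating at `(p - 1) / 2` loses only terms divisible by `p`. -/
theorem ZMod.sum_centralBinom_half (p : ℕ) [hp : Fact p.Prime] :
    ∑ m ∈ range ((p - 1) / 2), (-1 : ZMod p) ^ (m + 1) * (2 * (m + 1)).choose (m + 1) /
        ((m + 1 : ℕ) : ZMod p) ^ 2 =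
      ∑ m ∈ range (p - 1), (-1 : ZMod p) ^ (m + 1) * (2 * (m + 1)).choose (m + 1) /
        ((m + 1 : ℕ) : ZMod p) ^ 2 := by
  refine sum_subset (range_subset_range.2 (Nat.div_le_self _ _)) fun m hm hm' => ?_
  rw [mem_range] at hm hm'
  rw [ZMod.centralBinom_eq_zero (by omega) (by omega), mul_zero, zero_div]

theorem stmt_6 (p : ℕ) (hp : p.Prime) (hp3 : 3 < p) (r : ℕ) (hr : 0 < r)
    (δ : ℕ) (hδ : δ = 1 ∨ δ = 2) :
    pcong p (2 * r + 3)
      (∑ n ∈ range ((p ^ r - 1) / δ + 1), F n ((p ^ r - 1) / 2))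
      ((p : ℚ) ^ (2 * r)) := by
  have := Fact.mk hp
  obtain ⟨r, rfl⟩ : ∃ s, r = s + 1 := ⟨r - 1, by omega⟩
  have hodd : Odd (p ^ (r + 1)) := (hp.odd_of_ne_two (by omega)).pow
  have hk : 2 * ((p ^ (r + 1) - 1) / 2) + 1 = p ^ (r + 1) := by
    obtain ⟨t, ht⟩ := hodd
    omega
  have hpos : 0 < p ^ r := pow_pos hp.pos r
  have hquot : (p ^ (r + 1) - 1) / p ^ r = p - 1 := by
    have hle : p ^ r * 1 ≤ p ^ r * p := Nat.mul_le_mul_left _ hp.one_le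
    rw [Nat.div_eq_iff hpos, pow_succ, Nat.sub_mul, mul_comm p]
    omega
  apply ReducesTo.pcong_of_sub_div
  rw [sum_range_succ', F_zero]
  have hkq : (2 * ((p ^ (r + 1) - 1) / 2 : ℕ) + 1 : ℚ) = (p : ℚ) ^ (r + 1) := by
    exact_mod_cast hk
  rw [hkq, ← pow_mul, mul_comm (r + 1) 2, add_sub_cancel_right, sum_div]
  have hle : (p ^ (r + 1) - 1) / δ ≤ p ^ (r + 1) - 1 := Nat.div_le_self _ _
  have key := ReducesTo.sum (p := p) (range ((p ^ (r + 1) - 1) / δ)) fun n hn =>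
    reducesTo_F_succ (p := p) (by omega) (n := n) hk (by have := mem_range.1 hn; omega)
  convert key using 1
  rw [sum_range_multiples (p ^ r) _ hpos (fun m => 10 / 16 * ((-1 : ZMod p) ^ m *
    (2 * m).choose m / (m : ZMod p) ^ 2)), ← mul_sum, Nat.div_div_eq_div_mul, mul_comm δ,
    ← Nat.div_div_eq_div_mul, hquot]
  have h5 := ZMod.five_mul_sum_centralBinom (p := p) hp3
  rcases hδ with rfl | rfl
  · rw [Nat.div_one]
    linear_combination (-(2 / 16) : ZMod p) * h5
  · rw [ZMod.sum_centralBinom_half p]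
    linear_combination (-(2 / 16) : ZMod p) * h5
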